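/- There is no rational solution (q1,p1,q2,p2) of A5^(2)(α0,α1,α2,α3) such that |q1(t)|, |p1(t)| and |p2(t)| all tend to ∞ as |t| → ∞ while q2(t) tends to a finite limit as |t| → ∞ (i.e., q1, p1, p2 have a pole at infinity and q2 is holomorphic at infinity). -/

import Mathlib

open Filter Topology Polynomial

/-- Evaluation of a rational function with complex coefficients at a point,
using its reduced numerator and denominator. -/
noncomputable def evR (f : RatFunc ℂ) (t : ℂ) : ℂ := f.num.eval t / f.denom.eval t

/-- A rational function has no pole at `c` if its reduced denominator does not vanish at `c`. -/
def NoPoleAt (f : RatFunc ℂ) (c : ℂ) : Prop := f.denom.eval c ≠ 0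

/-- `(q1, p1, q2, p2)` is a rational solution of the Sasano system
`A5^(2)(α0, α1, α2, α3)` (the parameter `α2` does not occur in the equations):
the four differential equations hold at every point `t ∈ ℂ` which is not a pole
of any of `q1, p1, q2, p2`. -/
def IsSasanoSol (a0 a1 a3 : ℂ) (q1 p1 q2 p2 : RatFunc ℂ) : Prop :=
  ∀ t : ℂ, NoPoleAt q1 t → NoPoleAt p1 t → NoPoleAt q2 t → NoPoleAt p2 t →
    (t * deriv (evR q1) t =
      2 * (evR q1 t) ^ 2 * evR p1 t - (evR q1 t) ^ 2 + (a0 + a1 + a3) * evR q1 t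
        - t + 4 * t * evR p2 t + 2 * evR q1 t * evR q2 t * evR p2 t) ∧
    (t * deriv (evR p1) t =
      -2 * evR q1 t * (evR p1 t) ^ 2 + 2 * evR q1 t * evR p1 t
        - (a0 + a1 + a3) * evR p1 t + a0 - 2 * evR p1 t * evR q2 t * evR p2 t) ∧
    (t * deriv (evR q2) t =
      2 * (evR q2 t) ^ 2 * evR p2 t - (evR q2 t) ^ 2 + (a0 + a1 + a3) * evR q2 t
        - t + 4 * t * evR p1 t + 2 * evR q1 t * evR p1 t * evR q2 t) ∧
    (t * deriv (evR p2) t =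
      -2 * evR q2 t * (evR p2 t) ^ 2 + 2 * evR q2 t * evR p2 t
        - (a0 + a1 + a3) * evR p2 t + a1 - 2 * evR q1 t * evR p1 t * evR p2 t)

/-- The logarithmic derivative of a nonzero polynomial, times `t`, is bounded near infinity. -/
theorem poly_logDeriv_bdd_aux (s : Multiset ℂ) :
    ∃ K : ℝ, ∀ᶠ t in cocompact ℂ, ((s.map (fun r => X - C r)).prod).eval t ≠ 0 ∧
      ‖t * (((s.map (fun r => X - C r)).prod).derivative.eval t
        / ((s.map (fun r => X - C r)).prod).eval t)‖ ≤ K := by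
  induction s using Multiset.induction_on with
  | empty => exact ⟨0, by simp⟩
  | cons r s ih =>
    obtain ⟨K, hK⟩ := ih
    refine ⟨2 + K, ?_⟩
    have h1 : ∀ᶠ t : ℂ in cocompact ℂ, 2 * ‖r‖ + 1 ≤ ‖t‖ :=
      (tendsto_norm_cocompact_atTop (E := ℂ)).eventually_ge_atTop _
    filter_upwards [hK, h1] with t ht h1
    obtain ⟨hne, hb⟩ := ht
    have h2 : ‖t‖ ≤ ‖t - r‖ + ‖r‖ := by simpa using norm_add_le (t - r) r
    have h3 : ‖t‖ ≤ 2 * ‖t - r‖ := by linarith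
    have h4 : 0 < ‖t - r‖ := by linarith [norm_nonneg r]
    have h5 : t - r ≠ 0 := norm_pos_iff.mp h4
    rw [Multiset.map_cons, Multiset.prod_cons]
    set Q := (s.map (fun r => X - C r)).prod
    refine ⟨by simpa using ⟨h5, hne⟩, ?_⟩
    have e : t * (((X - C r) * Q).derivative.eval t / ((X - C r) * Q).eval t)
        = t / (t - r) + t * (Q.derivative.eval t / Q.eval t) := by
      simp only [derivative_mul, derivative_sub, derivative_X, derivative_C, eval_add, eval_mul,
        eval_sub, eval_X, eval_C, sub_zero, eval_one]
      field_simp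
    rw [e]
    refine (norm_add_le _ _).trans (add_le_add ?_ hb)
    rw [norm_div, div_le_iff₀ h4]
    exact h3

theorem poly_logDeriv_bdd (P : ℂ[X]) (hP : P ≠ 0) :
    ∃ K : ℝ, ∀ᶠ t in cocompact ℂ, P.eval t ≠ 0 ∧
      ‖t * (P.derivative.eval t / P.eval t)‖ ≤ K := by
  obtain ⟨K, hK⟩ := poly_logDeriv_bdd_aux P.roots
  refine ⟨K, ?_⟩
  have hs : P = C P.leadingCoeff * (P.roots.map (fun r => X - C r)).prod :=
    (IsAlgClosed.splits P).eq_prod_roots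
  have hl : P.leadingCoeff ≠ 0 := leadingCoeff_ne_zero.mpr hP
  filter_upwards [hK] with t ht
  set Q := (P.roots.map (fun r => X - C r)).prod
  rw [hs]
  simp only [derivative_mul, derivative_C, zero_mul, zero_add, eval_mul, eval_C]
  rw [mul_div_mul_left _ _ hl]
  exact ⟨mul_ne_zero hl ht.1, ht.2⟩

theorem rat_logDeriv_bdd (f : RatFunc ℂ) (hf : f ≠ 0) :
    ∃ K : ℝ, ∀ᶠ t in cocompact ℂ, NoPoleAt f t ∧ ‖t * deriv (evR f) t / evR f t‖ ≤ K := by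
  obtain ⟨K, hK⟩ := poly_logDeriv_bdd f.num (RatFunc.num_ne_zero hf)
  obtain ⟨M, hM⟩ := poly_logDeriv_bdd f.denom f.denom_ne_zero
  refine ⟨K + M, ?_⟩
  filter_upwards [hK, hM] with t h1 h2
  obtain ⟨n1, b1⟩ := h1
  obtain ⟨n2, b2⟩ := h2
  refine ⟨n2, ?_⟩
  have hd : deriv (evR f) t = (f.num.derivative.eval t * f.denom.eval t
      - f.num.eval t * f.denom.derivative.eval t) / f.denom.eval t ^ 2 :=
    ((f.num.hasDerivAt t).div (f.denom.hasDerivAt t) n2).deriv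
  have e : t * deriv (evR f) t / evR f t = t * (f.num.derivative.eval t / f.num.eval t)
      - t * (f.denom.derivative.eval t / f.denom.eval t) := by
    rw [hd, evR]
    field_simp
  rw [e]
  exact (norm_sub_le _ _).trans (add_le_add b1 b2)

theorem sasano_no_solution_q1p1p2_pole_at_infinity (a0 a1 a2 a3 : ℂ)
    (hpar : a0 + a1 + 2 * a2 + a3 = 1 / 2) :
    ¬ ∃ q1 p1 q2 p2 : RatFunc ℂ, IsSasanoSol a0 a1 a3 q1 p1 q2 p2 ∧
      Tendsto (fun t => ‖evR q1 t‖) (cocompact ℂ) atTop ∧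
      Tendsto (fun t => ‖evR p1 t‖) (cocompact ℂ) atTop ∧
      Tendsto (fun t => ‖evR p2 t‖) (cocompact ℂ) atTop ∧
      ∃ L : ℂ, Tendsto (evR q2) (cocompact ℂ) (𝓝 L) := by
  rintro ⟨q1, p1, q2, p2, hsol, hq1, hp1, hp2, L, hq2⟩
  have ne0 : ∀ f : RatFunc ℂ, Tendsto (fun t => ‖evR f t‖) (cocompact ℂ) atTop → f ≠ 0 := by
    rintro f hf rfl
    obtain ⟨t, ht⟩ := (hf.eventually_ge_atTop 1).exists
    simp [evR] at ht
    linarith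
  have np : ∀ f : RatFunc ℂ, ∀ᶠ t in cocompact ℂ, NoPoleAt f t := by
    intro f
    obtain ⟨K, hK⟩ := poly_logDeriv_bdd f.denom f.denom_ne_zero
    exact hK.mono fun t h => h.1
  obtain ⟨K, hK⟩ := rat_logDeriv_bdd p1 (ne0 p1 hp1)
  obtain ⟨M, hM⟩ := rat_logDeriv_bdd p2 (ne0 p2 hp2)
  obtain ⟨t, hK, hM, n1, n3, g1, g2, g3, g4⟩ :=
    (hK.and (hM.and ((np q1).and ((np q2).and
      ((hq1.eventually_gt_atTop (K + M + 2 * (‖L‖ + 1) + ‖a0‖ + ‖a1‖)).and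
      ((hp1.eventually_ge_atTop 1).and ((hp2.eventually_ge_atTop 1).and
        (hq2.norm.eventually_lt_const (lt_add_one ‖L‖))))))))).exists
  obtain ⟨n2, b1⟩ := hK
  obtain ⟨n4, b2⟩ := hM
  obtain ⟨-, e1, -, e2⟩ := hsol t n1 n2 n3 n4
  rw [e1] at b1
  rw [e2] at b2
  generalize evR q1 t = x at *
  generalize evR p1 t = y at *
  generalize evR q2 t = z at *
  generalize evR p2 t = w at *
  have hy : y ≠ 0 := norm_pos_iff.mp (by linarith)
  have hw : w ≠ 0 := norm_pos_iff.mp (by linarith)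
  set A := (-2 * x * y ^ 2 + 2 * x * y - (a0 + a1 + a3) * y + a0 - 2 * y * z * w) / y with hA
  set B := (-2 * z * w ^ 2 + 2 * z * w - (a0 + a1 + a3) * w + a1 - 2 * x * y * w) / w with hB
  have key : 2 * x = A - B + 2 * z - a0 / y + a1 / w := by
    rw [hA, hB]
    field_simp
    ring
  have c1 : ‖a0 / y‖ ≤ ‖a0‖ := by
    rw [norm_div]; exact div_le_self (norm_nonneg _) g2
  have c2 : ‖a1 / w‖ ≤ ‖a1‖ := by
    rw [norm_div]; exact div_le_self (norm_nonneg _) g3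
  have c3 : ‖2 * x‖ = 2 * ‖x‖ := by simp
  have c4 : ‖2 * z‖ = 2 * ‖z‖ := by simp
  have d1 := norm_add_le (A - B + 2 * z - a0 / y) (a1 / w)
  have d2 := norm_sub_le (A - B + 2 * z) (a0 / y)
  have d3 := norm_add_le (A - B) (2 * z)
  have d4 := norm_sub_le A B
  rw [← key, c3] at d1
  linarith [norm_nonneg x, norm_nonneg A, norm_nonneg B, norm_nonneg z]
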